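/- Functoriality of the lift: with X ∈ C^p_ω([0,T],V), H̄ ∈ D_X(U), H := ↑_X H̄, and K̄ ∈ D_H(S), the lift of the composite controlled path equals the iterated lift: ↑_X(K̄ * H̄) = ↑_H K̄ in C^p_ω([0,T],S). In particular F_*(↑_X H̄) = ↑_X(F_* H̄) for smooth F, and F_*(G_*X) = (F∘G)_*X for smooth composable maps F, G. -/

import Mathlib

/-- Multiset of all shuffles (interleavings) of two lists. -/
def shuffles {α : Type*} : List α → List α → Multiset (List α)
  | [], bs => {bs}
  | a :: as, [] => {a :: as}
  | a :: as, b :: bs =>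
      (shuffles as (b :: bs)).map (a :: ·) + (shuffles (a :: as) bs).map (b :: ·)
termination_by as bs => as.length + bs.length

/-- A control function on `[0,T]`: continuous, vanishing on the diagonal,
nonnegative, superadditive. -/
def IsControl (ω : ℝ → ℝ → ℝ) (T : ℝ) : Prop :=
  Continuous (fun st : ℝ × ℝ => ω st.1 st.2) ∧ (∀ t, ω t t = 0) ∧
    (∀ s t, 0 ≤ ω s t) ∧
    ∀ s u t, 0 ≤ s → s ≤ u → u ≤ t → t ≤ T → ω s u + ω u t ≤ ω s t

/-- A `p`-weakly geometric rough path on `[0,T]` with values in `ℝ^d`,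
in coordinates: `X s t w` is the coefficient `⟨X_{s,t}, e_w⟩` of the word `w`.
It is truncated at level `⌊p⌋`, starts at `1` in degree `0`, is continuous,
has `ω`-Hölder regularity `ω(s,t)^{|w|/p}`, satisfies Chen's multiplicativity
identity, and the shuffle (integration-by-parts/geometricity) identity. -/
structure RoughPath (d : ℕ) (p T : ℝ) (ω : ℝ → ℝ → ℝ) where
  X : ℝ → ℝ → List (Fin d) → ℝ
  empty_eq : ∀ s t, X s t [] = 1
  zero_of_high : ∀ s t (w : List (Fin d)), ⌊p⌋₊ < w.length → X s t w = 0
  cont : ∀ w, Continuous fun st : ℝ × ℝ => X st.1 st.2 w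
  regularity : ∃ C, ∀ w : List (Fin d), w.length ≤ ⌊p⌋₊ → ∀ s t, 0 ≤ s → s ≤ t → t ≤ T →
    |X s t w| ≤ C * ω s t ^ ((w.length : ℝ) / p)
  chen : ∀ s u t, 0 ≤ s → s ≤ u → u ≤ t → t ≤ T → ∀ w : List (Fin d), w.length ≤ ⌊p⌋₊ →
    X s t w = ∑ i ∈ Finset.range (w.length + 1), X s u (w.take i) * X u t (w.drop i)
  shuffle_rel : ∀ s t, 0 ≤ s → s ≤ t → t ≤ T → ∀ a b : List (Fin d),
    a.length + b.length ≤ ⌊p⌋₊ →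
    X s t a * X s t b = ((shuffles a b).map (X s t)).sum

/-- Half (ordered) shuffle of two words: the shuffles in which the last letter
of the second word stays last.  Convention: `osh2 a [] = 0`, `osh2 [] b = {b}`. -/
def osh2 {α : Type*} (a b : List α) : Multiset (List α) :=
  match b.getLast? with
  | none => 0
  | some x => (shuffles a b.dropLast).map (· ++ [x])

/-- Multiset of ordered shuffles of a list of words. -/
def oshMany {α : Type*} (ws : List (List α)) : Multiset (List α) :=
  ws.foldl (fun acc w => acc.bind fun u => osh2 u w) {([] : List α)}

/-- Bounded words: words over `Fin d` of length at most `N`. -/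
abbrev BWord (d N : ℕ) := Σ l : Fin (N + 1), Fin (l : ℕ) → Fin d

/-- The word (list) underlying a bounded word. -/
def bwList {d N : ℕ} (g : BWord d N) : List (Fin d) := List.ofFn g.2

/-- A path `H` controlled by the rough path (coordinates) `X`: it is valued in
`L(T^{⌊p⌋−1}(V), U)` (so truncated at level `⌊p⌋−1`), continuous, each level
is `ω^{1/p}`-regular, and the Gubinelli compatibility estimates hold:
for `|β| ≤ ⌊p⌋−2`,
`H_t^β − ∑_{|α| ≤ ⌊p⌋−1−|β|} H_s^{αβ} X_{s,t}^α = O(ω(s,t)^{(⌊p⌋−|β|)/p})`. -/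
def IsControlledPath (d : ℕ) {ι : Type*} (p T : ℝ) (ω : ℝ → ℝ → ℝ)
    (X : ℝ → ℝ → List (Fin d) → ℝ) (H : ℝ → List (Fin d) → ι → ℝ) : Prop :=
  (∀ t (w : List (Fin d)) k, ⌊p⌋₊ - 1 < w.length → H t w k = 0) ∧
  (∀ w k, Continuous fun t => H t w k) ∧
  (∃ C, ∀ w : List (Fin d), w.length ≤ ⌊p⌋₊ - 1 →
    ∀ s t, 0 ≤ s → s ≤ t → t ≤ T → ∀ k,
      |H t w k - H s w k| ≤ C * ω s t ^ (1 / p)) ∧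
  (∃ C, ∀ (b : ℕ) (β : Fin b → Fin d), b ≤ ⌊p⌋₊ - 2 →
    ∀ s t, 0 ≤ s → s ≤ t → t ≤ T → ∀ k,
      |H t (List.ofFn β) k -
          ∑ l ∈ Finset.range (⌊p⌋₊ - b), ∑ α : Fin l → Fin d,
            H s (List.ofFn α ++ List.ofFn β) k * X s t (List.ofFn α)|
        ≤ C * ω s t ^ (((⌊p⌋₊ : ℝ) - b) / p))

/-- The lift approximant `↾_X H̄` of a controlled path: `(↾_X H̄)⁰ = 1`,
`(↾_X H̄)¹_{s,t} = H_{s,t}`, and for `m ≥ 2`,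
`(↾_X H̄)^m_{s,t} = ⟨H̄_s^{⊠m}, Δ̃_{OSh}^m X_{s,t}⟩`, i.e. in coordinates the
sum over tuples of nonempty words `γ¹,…,γᵐ` of total length ≤ N of
`H_s^{γ¹}(k₁)⋯H_s^{γᵐ}(k_m) · ∑_{γ ∈ OSh(γ¹,…,γᵐ)} X_{s,t}^γ`. -/
noncomputable def liftApprox (d : ℕ) {ι : Type*} (N : ℕ)
    (X : ℝ → ℝ → List (Fin d) → ℝ) (H : ℝ → List (Fin d) → ι → ℝ)
    (s t : ℝ) : List ι → ℝ
  | [] => 1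
  | [k] => H t [] k - H s [] k
  | k1 :: k2 :: ks =>
      ∑ g : Fin (k1 :: k2 :: ks).length → BWord d N,
        if (∀ i, 1 ≤ ((g i).1 : ℕ)) ∧ (∑ i, ((g i).1 : ℕ)) ≤ N then
          (∏ i, H s (bwList (g i)) ((k1 :: k2 :: ks).get i)) *
            ((oshMany (List.ofFn fun i => bwList (g i))).map (X s t)).sum
        else 0

/-- Change of controlling rough path `K̄ * H̄`, in coordinates:
`(K̄*H̄)^c_γ = Σ_{m, (γ¹,…,γᵐ) ∈ OSh⁻¹(γ), γⁱ ≠ ∅} K^c_{(k₁…k_m)} H^{k₁}_{γ¹} ⋯ H^{k_m}_{γᵐ}`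
(with the multiplicity of `γ` in `OSh(γ¹,…,γᵐ)`), `(K̄*H̄)^c_∅ = K^c_∅`,
truncated above level `N`. -/
noncomputable def starComp (d e f N : ℕ) (K : ℝ → List (Fin e) → Fin f → ℝ)
    (H : ℝ → List (Fin d) → Fin e → ℝ) (s : ℝ) (γ : List (Fin d)) (c : Fin f) : ℝ :=
  if N < γ.length then 0
  else if γ = [] then K s [] c
  else
    ∑ m ∈ Finset.Icc 1 γ.length, ∑ g : Fin m → BWord d N,
      ((oshMany (List.ofFn fun i => bwList (g i))).count γ : ℝ) *
        ∑ ks : Fin m → Fin e, K s (List.ofFn ks) c * ∏ i, H s (bwList (g i)) (ks i)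

section Shuffles

variable {α : Type*}

theorem shuffles_nil_left (b : List α) : shuffles [] b = {b} := by
  rw [shuffles]

theorem shuffles_nil_right (a : List α) : shuffles a [] = {a} := by
  cases a <;> rw [shuffles]

theorem shuffles_cons_cons (x y : α) (a b : List α) :
    shuffles (x :: a) (y :: b) =
      (shuffles a (y :: b)).map (x :: ·) + (shuffles (x :: a) b).map (y :: ·) := by
  rw [shuffles]

theorem shuffles_comm (a b : List α) : shuffles a b = shuffles b a := by
  induction a generalizing b with
  | nil => rw [shuffles_nil_left, shuffles_nil_right]
  | cons x a iha =>
    induction b with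
    | nil => rw [shuffles_nil_left, shuffles_nil_right]
    | cons y b ihb =>
      rw [shuffles_cons_cons, shuffles_cons_cons, iha, ihb, add_comm]

theorem length_of_mem_shuffles {a b w : List α} (h : w ∈ shuffles a b) :
    w.length = a.length + b.length := by
  induction a generalizing b w with
  | nil => simp_all [shuffles_nil_left]
  | cons x a iha =>
    induction b generalizing w with
    | nil => simp_all [shuffles_nil_right]
    | cons y b ihb =>
      rw [shuffles_cons_cons, Multiset.mem_add, Multiset.mem_map, Multiset.mem_map] at h
      rcases h with ⟨u, hu, rfl⟩ | ⟨u, hu, rfl⟩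
      · have := iha hu
        simp only [List.length_cons] at *
        omega
      · have := ihb hu
        simp only [List.length_cons] at *
        omega

/-- Recursion of the shuffle product on the last letters. -/
theorem shuffles_concat_concat (x y : α) (a b : List α) :
    shuffles (a ++ [x]) (b ++ [y]) =
      (shuffles a (b ++ [y])).map (· ++ [x]) + (shuffles (a ++ [x]) b).map (· ++ [y]) := by
  induction a generalizing b with
  | nil =>
    induction b with
    | nil => simp [shuffles_cons_cons, shuffles_nil_left, shuffles_nil_right, add_comm]
    | cons z b ihb =>
      simp only [List.nil_append, List.cons_append] at ihb ⊢
      rw [shuffles_cons_cons, ihb, shuffles_cons_cons]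
      simp only [shuffles_nil_left, Multiset.map_add, Multiset.map_map, Multiset.map_singleton,
        Function.comp_def, List.cons_append]
      abel
  | cons u a iha =>
    induction b with
    | nil =>
      have h := iha []
      simp only [List.nil_append, List.cons_append] at h ⊢
      rw [shuffles_cons_cons, h, shuffles_cons_cons]
      simp only [shuffles_nil_right, Multiset.map_add, Multiset.map_map, Multiset.map_singleton,
        Function.comp_def, List.cons_append]
      abel
    | cons z b ihb =>
      have h := iha (z :: b)
      simp only [List.cons_append] at h ihb ⊢
      rw [shuffles_cons_cons, h, ihb, shuffles_cons_cons, shuffles_cons_cons]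
      simp only [Multiset.map_add, Multiset.map_map, Function.comp_def, List.cons_append]
      abel

theorem Multiset.bind_singleton_self {β : Type*} (s : Multiset β) : (s.bind fun a => {a}) = s := by
  simpa using Multiset.bind_singleton s id

theorem shuffles_bind_shuffles (a b c : List α) :
    ((shuffles a b).bind fun u => shuffles u c) = (shuffles b c).bind (shuffles a) := by
  induction a generalizing b c with
  | nil => simpa [shuffles_nil_left] using (Multiset.bind_singleton_self (shuffles b c)).symm
  | cons x a iha =>
    induction b generalizing c with
    | nil => simp [shuffles_nil_left, shuffles_nil_right]
    | cons y b ihb =>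
      induction c with
      | nil => simpa [shuffles_nil_right] using Multiset.bind_singleton_self (shuffles (x :: a) (y :: b))
      | cons z c ihc =>
        have e1 := iha (y :: b) (z :: c)
        have e2 := ihb (z :: c)
        rw [shuffles_cons_cons, shuffles_cons_cons, Multiset.add_bind, Multiset.add_bind,
          Multiset.bind_map, Multiset.bind_map, Multiset.bind_map, Multiset.bind_map]
        rw [shuffles_cons_cons, Multiset.add_bind, Multiset.bind_map, Multiset.bind_map] at ihc
        rw [shuffles_cons_cons y z b c, Multiset.add_bind, Multiset.bind_map, Multiset.bind_map]
          at e1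
        simp only [shuffles_cons_cons, Multiset.bind_add, ← Multiset.map_bind] at e1 e2 ihc ⊢
        rw [e1, e2, add_add_add_comm, ← Multiset.map_add (fun v => z :: v), ihc]
        simp only [Multiset.map_add]
        abel

theorem osh2_nil_right (a : List α) : osh2 a [] = 0 := by
  simp [osh2]

theorem osh2_concat (a b : List α) (x : α) :
    osh2 a (b ++ [x]) = (shuffles a b).map (· ++ [x]) := by
  simp [osh2]

theorem length_of_mem_osh2 {a b w : List α} (h : w ∈ osh2 a b) :
    w.length = a.length + b.length ∧ b ≠ [] := by
  rcases b.eq_nil_or_concat' with rfl | ⟨b, x, rfl⟩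
  · simp [osh2_nil_right] at h
  · rw [osh2_concat, Multiset.mem_map] at h
    obtain ⟨u, hu, rfl⟩ := h
    have := length_of_mem_shuffles hu
    simp only [List.length_append, List.length_singleton]
    exact ⟨by omega, by simp⟩

theorem osh2_nil_left {b : List α} (hb : b ≠ []) : osh2 [] b = {b} := by
  rcases b.eq_nil_or_concat' with rfl | ⟨b, x, rfl⟩
  · exact absurd rfl hb
  · simp [osh2_concat, shuffles_nil_left]

theorem shuffles_eq_osh2_add_osh2 (a : List α) {b : List α} (hb : b ≠ []) :
    shuffles a b = osh2 a b + osh2 b a := by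
  rcases a.eq_nil_or_concat' with rfl | ⟨a, x, rfl⟩
  · rw [shuffles_nil_left, osh2_nil_left hb, osh2_nil_right, add_zero]
  · rcases b.eq_nil_or_concat' with rfl | ⟨b, y, rfl⟩
    · exact absurd rfl hb
    · rw [shuffles_concat_concat, osh2_concat, osh2_concat, shuffles_comm a, add_comm]

/-- The Zinbiel identity of the half shuffle. -/
theorem osh2_bind_osh2 (a b c : List α) :
    (osh2 b c).bind (osh2 a) = (shuffles a b).bind fun u => osh2 u c := by
  rcases c.eq_nil_or_concat' with rfl | ⟨c, x, rfl⟩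
  · simp [osh2_nil_right]
  · simp only [osh2_concat, Multiset.bind_map, ← Multiset.map_bind, shuffles_bind_shuffles]

theorem oshMany_concat (ws : List (List α)) (w : List α) :
    oshMany (ws ++ [w]) = (oshMany ws).bind fun u => osh2 u w := by
  simp [oshMany]

theorem length_of_mem_oshMany {ws : List (List α)} {w : List α} (h : w ∈ oshMany ws) :
    w.length = (ws.map List.length).sum ∧ ∀ u ∈ ws, u ≠ [] := by
  induction ws using List.reverseRecOn generalizing w with
  | nil => simp_all [oshMany]
  | append_singleton ws v ih =>
    rw [oshMany_concat, Multiset.mem_bind] at h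
    obtain ⟨u, hu, hw⟩ := h
    obtain ⟨h1, h2⟩ := ih hu
    obtain ⟨h3, h4⟩ := length_of_mem_osh2 hw
    refine ⟨by simp [h3, h1], fun y hy => ?_⟩
    rcases List.mem_append.1 hy with hy | hy
    · exact h2 y hy
    · rw [List.mem_singleton.1 hy]
      exact h4

end Shuffles

noncomputable section WordSums

variable {α β : Type*}

/-- The formal sum of the words of a multiset. -/
def wordSum (s : Multiset (List α)) : List α →₀ ℝ :=
  (s.map fun w => Finsupp.single w (1 : ℝ)).sum

/-- The bilinear extension of a multiset-valued product of words. -/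
def wordProd (m : List α → List α → Multiset (List α)) :
    (List α →₀ ℝ) →ₗ[ℝ] (List α →₀ ℝ) →ₗ[ℝ] (List α →₀ ℝ) :=
  Finsupp.linearCombination ℝ fun a => Finsupp.linearCombination ℝ fun b => wordSum (m a b)

theorem wordSum_zero : wordSum (0 : Multiset (List α)) = 0 := by
  simp [wordSum]

theorem wordSum_singleton (a : List α) : wordSum {a} = Finsupp.single a 1 := by
  simp [wordSum]

theorem wordSum_add (s t : Multiset (List α)) : wordSum (s + t) = wordSum s + wordSum t := by
  simp [wordSum]

theorem map_wordSum {M : Type*} [AddCommMonoid M] [Module ℝ M] (f : (List α →₀ ℝ) →ₗ[ℝ] M)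
    (s : Multiset (List α)) :
    f (wordSum s) = (s.map fun w => f (Finsupp.single w 1)).sum := by
  rw [wordSum, map_multiset_sum, Multiset.map_map]
  rfl

theorem wordSum_bind {γ : Type*} (s : Multiset γ) (f : γ → Multiset (List α)) :
    wordSum (s.bind f) = (s.map fun a => wordSum (f a)).sum := by
  induction s using Multiset.induction_on with
  | empty => simp [wordSum_zero]
  | cons a s ih => simp [wordSum_add, ih]

theorem wordSum_apply [DecidableEq α] (s : Multiset (List α)) (w : List α) :
    wordSum s w = s.count w := by
  induction s using Multiset.induction_on with
  | empty => simp [wordSum_zero]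
  | cons a s ih =>
    rw [← Multiset.singleton_add, wordSum_add, Finsupp.add_apply, ih, wordSum_singleton,
      Finsupp.single_apply, Multiset.count_add, Multiset.count_singleton]
    simp [eq_comm]

theorem wordProd_single_single (m : List α → List α → Multiset (List α)) (a b : List α) :
    wordProd m (Finsupp.single a 1) (Finsupp.single b 1) = wordSum (m a b) := by
  simp [wordProd]

theorem wordProd_single_wordSum (m : List α → List α → Multiset (List α)) (a : List α)
    (s : Multiset (List α)) :
    wordProd m (Finsupp.single a 1) (wordSum s) = wordSum (s.bind (m a)) := by
  rw [map_wordSum, wordSum_bind]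
  simp only [wordProd_single_single]

theorem wordProd_wordSum_single (m : List α → List α → Multiset (List α)) (b : List α)
    (s : Multiset (List α)) :
    wordProd m (wordSum s) (Finsupp.single b 1) = wordSum (s.bind fun a => m a b) := by
  rw [wordSum_bind, ← LinearMap.flip_apply, map_wordSum]
  simp only [LinearMap.flip_apply, wordProd_single_single]

/-- The bilinear shuffle product. -/
abbrev shuffleProd : (List α →₀ ℝ) →ₗ[ℝ] (List α →₀ ℝ) →ₗ[ℝ] (List α →₀ ℝ) :=
  wordProd shuffles

/-- The bilinear half shuffle product. -/
abbrev halfProd : (List α →₀ ℝ) →ₗ[ℝ] (List α →₀ ℝ) →ₗ[ℝ] (List α →₀ ℝ) :=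
  wordProd osh2

/-- The iterated, left-nested half shuffle product. -/
def halfProdMany (vs : List (List α →₀ ℝ)) : List α →₀ ℝ :=
  vs.foldl (fun acc v => halfProd acc v) (Finsupp.single [] 1)

theorem single_eq_smul_one (a : List α) (r : ℝ) :
    Finsupp.single a r = r • Finsupp.single a (1 : ℝ) := by
  simp

theorem halfProd_halfProd (u v w : List α →₀ ℝ) :
    halfProd u (halfProd v w) = halfProd (shuffleProd u v) w := by
  induction u using Finsupp.induction_linear with
  | zero => simp
  | add u₁ u₂ h₁ h₂ => simp only [map_add, LinearMap.add_apply, h₁, h₂]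
  | single a r =>
    induction v using Finsupp.induction_linear with
    | zero => simp
    | add u₁ u₂ h₁ h₂ => simp only [map_add, LinearMap.add_apply, h₁, h₂]
    | single b q =>
      induction w using Finsupp.induction_linear with
      | zero => simp
      | add u₁ u₂ h₁ h₂ => simp only [map_add, h₁, h₂]
      | single c l =>
        rw [single_eq_smul_one a, single_eq_smul_one b, single_eq_smul_one c]
        simp only [map_smul, LinearMap.smul_apply, wordProd_single_single,
          wordProd_single_wordSum, wordProd_wordSum_single, osh2_bind_osh2]

theorem shuffleProd_comm (u v : List α →₀ ℝ) : shuffleProd u v = shuffleProd v u := by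
  induction u using Finsupp.induction_linear with
  | zero => simp
  | add u₁ u₂ h₁ h₂ => simp only [map_add, LinearMap.add_apply, h₁, h₂]
  | single a r =>
    induction v using Finsupp.induction_linear with
    | zero => simp
    | add u₁ u₂ h₁ h₂ => simp only [map_add, LinearMap.add_apply, h₁, h₂]
    | single b q =>
      rw [single_eq_smul_one a, single_eq_smul_one b]
      simp only [map_smul, LinearMap.smul_apply, wordProd_single_single, shuffles_comm a b]
      rw [smul_comm]

theorem shuffleProd_nil (u : List α →₀ ℝ) : shuffleProd u (Finsupp.single [] 1) = u := by
  induction u using Finsupp.induction_linear with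
  | zero => simp
  | add u₁ u₂ h₁ h₂ => simp only [map_add, LinearMap.add_apply, h₁, h₂]
  | single a r =>
    rw [single_eq_smul_one a]
    simp only [map_smul, LinearMap.smul_apply, wordProd_single_single, shuffles_nil_right,
      wordSum_singleton]

theorem halfProd_nil (u : List α →₀ ℝ) : halfProd u (Finsupp.single [] 1) = 0 := by
  induction u using Finsupp.induction_linear with
  | zero => simp
  | add u₁ u₂ h₁ h₂ => simp only [map_add, LinearMap.add_apply, h₁, h₂, add_zero]
  | single a r =>
    rw [single_eq_smul_one a]
    simp only [map_smul, LinearMap.smul_apply, wordProd_single_single, osh2_nil_right,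
      wordSum_zero, smul_zero]

theorem shuffleProd_wordSum (a : List α) (s : Multiset (List α)) (hs : ∀ w ∈ s, w ≠ []) :
    shuffleProd (Finsupp.single a 1) (wordSum s) =
      halfProd (Finsupp.single a 1) (wordSum s) + halfProd (wordSum s) (Finsupp.single a 1) := by
  rw [wordProd_single_wordSum, wordProd_single_wordSum, wordProd_wordSum_single, ← wordSum_add,
    ← Multiset.bind_add]
  congr 1
  exact Multiset.bind_congr fun w hw => shuffles_eq_osh2_add_osh2 a (hs w hw)

/-- The shuffle product is the symmetrized half shuffle product as soon as one factor has no
constant term. -/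
theorem shuffleProd_halfProd (u v w : List α →₀ ℝ) :
    shuffleProd u (halfProd v w) = halfProd u (halfProd v w) + halfProd (halfProd v w) u := by
  induction u using Finsupp.induction_linear with
  | zero => simp
  | add u₁ u₂ h₁ h₂ =>
    simp only [map_add, LinearMap.add_apply, h₁, h₂]
    abel
  | single a r =>
    induction v using Finsupp.induction_linear with
    | zero => simp
    | add u₁ u₂ h₁ h₂ =>
      simp only [map_add, LinearMap.add_apply, h₁, h₂]
      abel
    | single b q =>
      induction w using Finsupp.induction_linear with
      | zero => simp
      | add u₁ u₂ h₁ h₂ =>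
        simp only [map_add, LinearMap.add_apply, h₁, h₂]
        abel
      | single c l =>
        have hs : ∀ w ∈ osh2 b c, w ≠ [] := fun w hw hw0 => by
          obtain ⟨h1, h2⟩ := length_of_mem_osh2 hw
          rw [hw0, List.length_nil] at h1
          exact h2 (List.length_eq_zero_iff.1 (by omega))
        rw [single_eq_smul_one a, single_eq_smul_one b, single_eq_smul_one c]
        simp only [map_smul, LinearMap.smul_apply, wordProd_single_single,
          shuffleProd_wordSum a _ hs]
        module

theorem shuffleProd_halfProd_halfProd (u u' v v' : List α →₀ ℝ) :
    shuffleProd (halfProd u u') (halfProd v v') =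
      halfProd (shuffleProd u (halfProd v v')) u' + halfProd (shuffleProd (halfProd u u') v) v' := by
  rw [shuffleProd_halfProd, halfProd_halfProd (halfProd u u'), halfProd_halfProd (halfProd v v'),
    shuffleProd_comm _ u, add_comm]

theorem halfProdMany_concat (vs : List (List α →₀ ℝ)) (v : List α →₀ ℝ) :
    halfProdMany (vs ++ [v]) = halfProd (halfProdMany vs) v := by
  simp [halfProdMany]

/-- Multilinear expansion of the iterated half shuffle product. -/
theorem halfProdMany_ofFn_sum {ι : Type*} [Fintype ι] (W : ι → List α) (n : ℕ)
    (c : Fin n → ι → ℝ) :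
    halfProdMany (List.ofFn fun i => ∑ g, c i g • Finsupp.single (W g) (1 : ℝ)) =
      ∑ g : Fin n → ι, (∏ i, c i (g i)) • wordSum (oshMany (List.ofFn fun i => W (g i))) := by
  induction n with
  | zero => simp [halfProdMany, oshMany, wordSum_singleton]
  | succ n ih =>
    rw [List.ofFn_succ', List.concat_eq_append, halfProdMany_concat, ih fun i => c i.castSucc,
      ← (Fin.snocEquiv fun _ => ι).sum_comp, Fintype.sum_prod_type, map_sum]
    refine Finset.sum_congr rfl fun x _ => ?_
    rw [map_sum, LinearMap.sum_apply]
    refine Finset.sum_congr rfl fun g _ => ?_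
    rw [List.ofFn_succ', List.concat_eq_append, oshMany_concat, ← wordProd_wordSum_single,
      Fin.prod_univ_castSucc]
    simp only [Fin.snocEquiv_apply, Fin.snoc_castSucc, Fin.snoc_last, map_smul,
      LinearMap.smul_apply, smul_smul]
    rw [mul_comm]

/-- The half shuffle morphism determined by the images of the letters. -/
def halfProdHom (φ : α → List β →₀ ℝ) : (List α →₀ ℝ) →ₗ[ℝ] (List β →₀ ℝ) :=
  Finsupp.linearCombination ℝ fun w => halfProdMany (w.map φ)

theorem halfProdHom_single (φ : α → List β →₀ ℝ) (w : List α) :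
    halfProdHom φ (Finsupp.single w 1) = halfProdMany (w.map φ) := by
  simp [halfProdHom]

theorem halfProdHom_wordSum_concat (φ : α → List β →₀ ℝ) (s : Multiset (List α)) (x : α) :
    halfProdHom φ (wordSum (s.map (· ++ [x]))) = halfProd (halfProdHom φ (wordSum s)) (φ x) := by
  rw [map_wordSum, map_wordSum, Multiset.map_map, ← LinearMap.flip_apply,
    map_multiset_sum, Multiset.map_map]
  simp [Function.comp_def, halfProdHom_single, halfProdMany_concat]

theorem halfProdMany_map_concat (φ : α → List β →₀ ℝ) (w : List α) (x : α) :
    halfProdMany ((w ++ [x]).map φ) = halfProd (halfProdMany (w.map φ)) (φ x) := by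
  rw [List.map_append, List.map_singleton, halfProdMany_concat]

theorem halfProdHom_shuffles (φ : α → List β →₀ ℝ) (a b : List α) :
    halfProdHom φ (wordSum (shuffles a b)) =
      shuffleProd (halfProdMany (a.map φ)) (halfProdMany (b.map φ)) := by
  induction a using List.reverseRecOn generalizing b with
  | nil =>
    rw [shuffles_nil_left, wordSum_singleton, halfProdHom_single, shuffleProd_comm]
    exact (shuffleProd_nil _).symm
  | append_singleton a x iha =>
    induction b using List.reverseRecOn with
    | nil =>
      rw [shuffles_nil_right, wordSum_singleton, halfProdHom_single]
      exact (shuffleProd_nil _).symm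
    | append_singleton b y ihb =>
      rw [shuffles_concat_concat, wordSum_add, map_add, halfProdHom_wordSum_concat,
        halfProdHom_wordSum_concat, iha, ihb, halfProdMany_map_concat, halfProdMany_map_concat,
        ← shuffleProd_halfProd_halfProd]

theorem halfProdHom_halfProd (φ : α → List β →₀ ℝ) (u v : List α →₀ ℝ) :
    halfProdHom φ (halfProd u v) = halfProd (halfProdHom φ u) (halfProdHom φ v) := by
  induction u using Finsupp.induction_linear with
  | zero => simp
  | add u₁ u₂ h₁ h₂ => simp only [map_add, LinearMap.add_apply, h₁, h₂]
  | single a r =>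
    induction v using Finsupp.induction_linear with
    | zero => simp
    | add u₁ u₂ h₁ h₂ => simp only [map_add, h₁, h₂]
    | single b q =>
      rw [single_eq_smul_one a, single_eq_smul_one b]
      simp only [map_smul, LinearMap.smul_apply, wordProd_single_single, halfProdHom_single]
      congr 2
      rcases b.eq_nil_or_concat' with rfl | ⟨b, x, rfl⟩
      · rw [osh2_nil_right, wordSum_zero, map_zero]
        exact (halfProd_nil _).symm
      · rw [osh2_concat, halfProdHom_wordSum_concat, halfProdHom_shuffles,
          halfProdMany_map_concat, halfProd_halfProd]

theorem halfProdHom_halfProdMany (φ : α → List β →₀ ℝ) (vs : List (List α →₀ ℝ)) :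
    halfProdHom φ (halfProdMany vs) = halfProdMany (vs.map (halfProdHom φ)) := by
  induction vs using List.reverseRecOn with
  | nil => simp [halfProdMany, halfProdHom_single]
  | append_singleton vs v ih =>
    rw [halfProdMany_concat, halfProdHom_halfProd, ih, List.map_append, List.map_singleton,
      halfProdMany_concat]

/-- The words of length at least `k` span a submodule of the formal sums of words. -/
abbrev wordsOfLengthGE (α : Type*) (k : ℕ) : Submodule ℝ (List α →₀ ℝ) :=
  Finsupp.supported ℝ ℝ {w : List α | k ≤ w.length}

theorem mem_wordsOfLengthGE {k : ℕ} {v : List α →₀ ℝ} :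
    v ∈ wordsOfLengthGE α k ↔ ∀ w, w.length < k → v w = 0 := by
  rw [Finsupp.mem_supported']
  simp

theorem wordSum_mem_wordsOfLengthGE {k : ℕ} {s : Multiset (List α)}
    (hs : ∀ w ∈ s, k ≤ w.length) : wordSum s ∈ wordsOfLengthGE α k := by
  refine multiset_sum_mem _ fun v hv => ?_
  obtain ⟨w, hw, rfl⟩ := Multiset.mem_map.1 hv
  exact Finsupp.single_mem_supported ℝ _ (hs w hw)

theorem halfProd_mem_wordsOfLengthGE {a b : ℕ} {u v : List α →₀ ℝ}
    (hu : u ∈ wordsOfLengthGE α a) (hv : v ∈ wordsOfLengthGE α b) :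
    halfProd u v ∈ wordsOfLengthGE α (a + max b 1) := by
  simp only [halfProd, wordProd, Finsupp.linearCombination_apply, Finsupp.sum,
    LinearMap.sum_apply, LinearMap.smul_apply]
  refine Submodule.sum_mem _ fun x hx => Submodule.smul_mem _ _ <|
    Submodule.sum_mem _ fun y hy => Submodule.smul_mem _ _ <|
    wordSum_mem_wordsOfLengthGE fun w hw => ?_
  have h1 : a ≤ x.length := hu hx
  have h2 : b ≤ y.length := hv hy
  obtain ⟨h3, h4⟩ := length_of_mem_osh2 hw
  have h5 := List.length_pos_iff.2 h4
  omega

theorem halfProdMany_mem_wordsOfLengthGE (vs : List (List α →₀ ℝ)) :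
    halfProdMany vs ∈ wordsOfLengthGE α vs.length := by
  induction vs using List.reverseRecOn with
  | nil => simp [mem_wordsOfLengthGE]
  | append_singleton vs v ih =>
    rw [halfProdMany_concat, List.length_append, List.length_singleton]
    have := halfProd_mem_wordsOfLengthGE (b := 0) ih (v := v) (by simp [mem_wordsOfLengthGE])
    simpa using this

/-- Changing the factors above length `N ≥ 1` changes an iterated half shuffle product of `m`
factors only above length `N + m - 1`. -/
theorem halfProdMany_sub_mem_wordsOfLengthGE {γ : Type*} {N : ℕ} (hN : 1 ≤ N)
    (f g : γ → List α →₀ ℝ) (hfg : ∀ c, f c - g c ∈ wordsOfLengthGE α N) (ws : List γ) :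
    halfProdMany (ws.map f) - halfProdMany (ws.map g) ∈
      wordsOfLengthGE α (N + ws.length - 1) := by
  induction ws using List.reverseRecOn with
  | nil => simp
  | append_singleton ws c ih =>
    rw [halfProdMany_map_concat, halfProdMany_map_concat]
    have h : halfProd (halfProdMany (ws.map f)) (f c) - halfProd (halfProdMany (ws.map g)) (g c) =
        halfProd (halfProdMany (ws.map f) - halfProdMany (ws.map g)) (f c) +
          halfProd (halfProdMany (ws.map g)) (f c - g c) := by
      simp only [map_sub, LinearMap.sub_apply]
      abel
    rw [h, List.length_append, List.length_singleton]
    refine Submodule.add_mem _ ?_ ?_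
    · have := halfProd_mem_wordsOfLengthGE (b := 0) ih (v := f c) (by simp [mem_wordsOfLengthGE])
      convert this using 2
      simp
      omega
    · have := halfProd_mem_wordsOfLengthGE (halfProdMany_mem_wordsOfLengthGE (ws.map g)) (hfg c)
      convert this using 2
      simp
      omega

end WordSums

noncomputable section Lift

/-- The formal sum of the words of length at most `N` with coefficients `G`. -/
def boundedSum (d N : ℕ) (G : List (Fin d) → ℝ) : List (Fin d) →₀ ℝ :=
  ∑ g : BWord d N, G (bwList g) • Finsupp.single (bwList g) (1 : ℝ)

theorem length_bwList {d N : ℕ} (g : BWord d N) : (bwList g).length = g.1 := by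
  simp [bwList]

theorem bwList_injective {d N : ℕ} : Function.Injective (bwList : BWord d N → List (Fin d)) := by
  rintro ⟨l, v⟩ ⟨l', v'⟩ h
  have hl : l = l' := Fin.ext (by simpa [bwList] using congrArg List.length h)
  subst hl
  simpa [bwList] using h

theorem exists_bwList_eq {d N : ℕ} {w : List (Fin d)} (hw : w.length ≤ N) :
    ∃ g : BWord d N, bwList g = w :=
  ⟨⟨⟨w.length, Nat.lt_succ_of_le hw⟩, w.get⟩, by simp [bwList]⟩

theorem boundedSum_apply (d N : ℕ) (G : List (Fin d) → ℝ) (w : List (Fin d)) :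
    boundedSum d N G w = if w.length ≤ N then G w else 0 := by
  simp only [boundedSum, Finsupp.finsetSum_apply, Finsupp.smul_apply, smul_eq_mul]
  split_ifs with hw
  · obtain ⟨g, rfl⟩ := exists_bwList_eq hw
    rw [Finset.sum_eq_single g]
    · simp
    · intro b _ hb
      rw [Finsupp.single_eq_of_ne (fun h => hb (bwList_injective h.symm)), mul_zero]
    · simp
  · refine Finset.sum_eq_zero fun g _ => ?_
    rw [Finsupp.single_eq_of_ne, mul_zero]
    rintro rfl
    rw [length_bwList] at hw
    omega

theorem halfProdMany_boundedSum {ι : Type*} (d N : ℕ) (G : List (Fin d) → ι → ℝ) (n : ℕ)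
    (k : Fin n → ι) :
    halfProdMany (List.ofFn fun i => boundedSum d N fun v => G v (k i)) =
      ∑ g : Fin n → BWord d N,
        (∏ i, G (bwList (g i)) (k i)) • wordSum (oshMany (List.ofFn fun i => bwList (g i))) :=
  halfProdMany_ofFn_sum bwList n fun i g => G (bwList g) (k i)

theorem length_of_mem_oshMany_bwList {d N n : ℕ} {g : Fin n → BWord d N} {w : List (Fin d)}
    (hw : w ∈ oshMany (List.ofFn fun i => bwList (g i))) :
    w.length = ∑ i, ((g i).1 : ℕ) ∧ ∀ i, 1 ≤ ((g i).1 : ℕ) := by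
  obtain ⟨h1, h2⟩ := length_of_mem_oshMany hw
  refine ⟨?_, fun i => ?_⟩
  · rw [h1, List.map_ofFn, List.sum_ofFn]
    simp [length_bwList]
  · have := List.length_pos_iff.2 (h2 (bwList (g i)) (List.mem_ofFn.2 ⟨i, rfl⟩))
    rwa [length_bwList] at this

theorem linearCombination_halfProdMany_boundedSum {ι : Type*} (d N : ℕ) (x : List (Fin d) → ℝ)
    (hx : ∀ w, N < w.length → x w = 0) (G : List (Fin d) → ι → ℝ) (n : ℕ) (k : Fin n → ι) :
    Finsupp.linearCombination ℝ x
        (halfProdMany (List.ofFn fun i => boundedSum d N fun v => G v (k i))) =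
      ∑ g : Fin n → BWord d N,
        if (∀ i, 1 ≤ ((g i).1 : ℕ)) ∧ (∑ i, ((g i).1 : ℕ)) ≤ N then
          (∏ i, G (bwList (g i)) (k i)) *
            ((oshMany (List.ofFn fun i => bwList (g i))).map x).sum
        else 0 := by
  rw [halfProdMany_boundedSum, map_sum]
  refine Finset.sum_congr rfl fun g _ => ?_
  rw [map_smul, map_wordSum, smul_eq_mul]
  simp only [Finsupp.linearCombination_single, one_smul]
  split_ifs with hg
  · rfl
  · rw [Multiset.sum_eq_zero, mul_zero]
    intro y hy
    obtain ⟨w, hw, rfl⟩ := Multiset.mem_map.1 hy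
    obtain ⟨h1, h2⟩ := length_of_mem_oshMany_bwList hw
    refine hx w ?_
    rw [h1]
    by_contra h
    exact hg ⟨h2, by omega⟩

theorem liftApprox_eq_sum {ι : Type*} (d N : ℕ) (X : ℝ → ℝ → List (Fin d) → ℝ)
    (H : ℝ → List (Fin d) → ι → ℝ) (s t : ℝ) {w : List ι} (hw : 2 ≤ w.length) :
    liftApprox d N X H s t w =
      ∑ g : Fin w.length → BWord d N,
        if (∀ i, 1 ≤ ((g i).1 : ℕ)) ∧ (∑ i, ((g i).1 : ℕ)) ≤ N then
          (∏ i, H s (bwList (g i)) (w.get i)) *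
            ((oshMany (List.ofFn fun i => bwList (g i))).map (X s t)).sum
        else 0 := by
  match w, hw with
  | k1 :: k2 :: ks, _ => rfl

theorem liftApprox_eq_linearCombination {ι : Type*} (d N : ℕ) (X : ℝ → ℝ → List (Fin d) → ℝ)
    (H : ℝ → List (Fin d) → ι → ℝ) (s t : ℝ) (hX : ∀ w, N < w.length → X s t w = 0)
    {w : List ι} (hw : 2 ≤ w.length) :
    liftApprox d N X H s t w =
      Finsupp.linearCombination ℝ (X s t)
        (halfProdMany (w.map fun k => boundedSum d N fun v => H s v k)) := by
  rw [liftApprox_eq_sum d N X H s t hw,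
    ← linearCombination_halfProdMany_boundedSum d N (X s t) hX (H s) _ w.get]
  congr 2
  conv_rhs => rw [← List.ofFn_get w, List.map_ofFn]
  rfl

theorem linearCombination_eq_zero_of_mem {d N k : ℕ} (hk : N < k) {x : List (Fin d) → ℝ}
    (hx : ∀ w, N < w.length → x w = 0) {v : List (Fin d) →₀ ℝ}
    (hv : v ∈ wordsOfLengthGE (Fin d) k) : Finsupp.linearCombination ℝ x v = 0 := by
  rw [Finsupp.linearCombination_apply, Finsupp.sum]
  refine Finset.sum_eq_zero fun w hw => ?_
  have h : k ≤ w.length := hv hw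
  rw [hx w (by omega), smul_zero]

/-- The coefficients of `starComp` are those of the image of `K` under the half shuffle morphism
determined by `H`, up to the truncation level. -/
theorem boundedSum_starComp_sub_mem (d e f N : ℕ) (hN : 1 ≤ N) (K : ℝ → List (Fin e) → Fin f → ℝ)
    (H : ℝ → List (Fin d) → Fin e → ℝ) (s : ℝ)
    (hH : ∀ (w : List (Fin d)) k, N - 1 < w.length → H s w k = 0) (c : Fin f) :
    (boundedSum d N fun v => starComp d e f (N - 1) K H s v c) -
        halfProdHom (fun k => boundedSum d N fun v => H s v k)
          (boundedSum e N fun v => K s v c) ∈ wordsOfLengthGE (Fin d) N := by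
  have hφ : (fun k => boundedSum d N fun v => H s v k) =
      fun k => boundedSum d (N - 1) fun v => H s v k := by
    funext k
    ext w
    rw [boundedSum_apply, boundedSum_apply]
    split_ifs with h1 h2 h2
    · rfl
    · exact hH w k (by omega)
    · omega
    · rfl
  rw [hφ]
  set φ : Fin e → List (Fin d) →₀ ℝ := fun k => boundedSum d (N - 1) fun v => H s v k with hφ'
  refine mem_wordsOfLengthGE.2 fun w hw => ?_
  rw [Finsupp.sub_apply, boundedSum_apply, if_pos hw.le, sub_eq_zero]
  have hR : halfProdHom φ (boundedSum e N fun v => K s v c) w =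
      ∑ l ∈ Finset.range (N + 1), ∑ ks : Fin l → Fin e,
        K s (List.ofFn ks) c * halfProdMany (List.ofFn fun i => φ (ks i)) w := by
    rw [boundedSum, map_sum, Finsupp.finsetSum_apply, Fintype.sum_sigma, Finset.sum_range]
    refine Finset.sum_congr rfl fun l _ => Finset.sum_congr rfl fun ks _ => ?_
    rw [map_smul, halfProdHom_single, Finsupp.smul_apply, smul_eq_mul, bwList, List.map_ofFn]
    rfl
  have hlong : ∀ l, w.length < l → ∀ ks : Fin l → Fin e,
      halfProdMany (List.ofFn fun i => φ (ks i)) w = 0 := fun l hl ks =>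
    mem_wordsOfLengthGE.1 (halfProdMany_mem_wordsOfLengthGE _) w (by simpa using hl)
  rw [hR, starComp, if_neg (by omega)]
  split_ifs with hw0
  · subst hw0
    rw [Finset.sum_eq_single 0]
    · simp [halfProdMany]
    · intro l _ hl
      refine Finset.sum_eq_zero fun ks _ => ?_
      rw [hlong l (Nat.pos_of_ne_zero hl), mul_zero]
    · simp
  · refine Eq.trans ?_ (Finset.sum_subset (s₁ := Finset.Icc 1 w.length) ?_ ?_)
    · refine Finset.sum_congr rfl fun l _ => ?_
      simp only [hφ', halfProdMany_boundedSum, Finsupp.finsetSum_apply, Finsupp.smul_apply,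
        wordSum_apply, smul_eq_mul, Finset.mul_sum]
      rw [Finset.sum_comm]
      refine Finset.sum_congr rfl fun ks _ => Finset.sum_congr rfl fun g _ => ?_
      ring
    · intro l hl
      simp only [Finset.mem_Icc, Finset.mem_range] at *
      omega
    · intro l _ hl
      refine Finset.sum_eq_zero fun ks _ => ?_
      by_cases h0 : l = 0
      · subst h0
        simp [halfProdMany, hw0]
      · rw [hlong l, mul_zero]
        simp only [Finset.mem_Icc] at hl
        omega

/-- The lift of a controlled path without the special treatment of the first level. -/
def letterLift (d : ℕ) {ι : Type*} (N : ℕ) (X : ℝ → ℝ → List (Fin d) → ℝ)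
    (H : ℝ → List (Fin d) → ι → ℝ) (s t : ℝ) (w : List ι) : ℝ :=
  Finsupp.linearCombination ℝ (X s t)
    (halfProdMany (w.map fun k => boundedSum d N fun v => H s v k))

theorem liftApprox_letterLift (d e f N : ℕ) (hN : 1 ≤ N) (X : ℝ → ℝ → List (Fin d) → ℝ)
    (K : ℝ → List (Fin e) → Fin f → ℝ) (H : ℝ → List (Fin d) → Fin e → ℝ) (s t : ℝ)
    (hX : ∀ w, N < w.length → X s t w = 0)
    (hH : ∀ (w : List (Fin d)) k, N - 1 < w.length → H s w k = 0)
    {w : List (Fin f)} (hw : 2 ≤ w.length) :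
    liftApprox e N (letterLift d N X H) K s t w =
      liftApprox d N X (starComp d e f (N - 1) K H) s t w := by
  have hlong : ∀ v, N < v.length → letterLift d N X H s t v = 0 := fun v hv =>
    linearCombination_eq_zero_of_mem hv hX (by
      simpa only [List.length_map] using
        halfProdMany_mem_wordsOfLengthGE (v.map fun k => boundedSum d N fun u => H s u k))
  have hcomp : Finsupp.linearCombination ℝ (letterLift d N X H s t) =
      (Finsupp.linearCombination ℝ (X s t)).comp
        (halfProdHom fun k => boundedSum d N fun v => H s v k) := by
    ext v
    simp [letterLift, halfProdHom_single]
  rw [liftApprox_eq_linearCombination _ _ _ _ _ _ hlong hw,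
    liftApprox_eq_linearCombination _ _ _ _ _ _ hX hw, hcomp, LinearMap.comp_apply,
    halfProdHom_halfProdMany, List.map_map, eq_comm, ← sub_eq_zero, ← map_sub]
  exact linearCombination_eq_zero_of_mem (k := N + w.length - 1) (by omega) hX
    (halfProdMany_sub_mem_wordsOfLengthGE hN _ _
      (boundedSum_starComp_sub_mem d e f N hN K H s hH) w)

theorem abs_liftApprox_sub_le {ι : Type*} (e N : ℕ) (Y Y' : ℝ → ℝ → List (Fin e) → ℝ)
    (K : ℝ → List (Fin e) → ι → ℝ) (s t ε M : ℝ)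
    (hY : ∀ w, 2 ≤ w.length → w.length ≤ N → |Y s t w - Y' s t w| ≤ ε)
    (hK : ∀ (g : BWord e N) k, |K s (bwList g) k| ≤ M) {w : List ι} (hw : 2 ≤ w.length) :
    |liftApprox e N Y K s t w - liftApprox e N Y' K s t w| ≤
      (∑ g : Fin w.length → BWord e N,
        M ^ w.length * (oshMany (List.ofFn fun i => bwList (g i))).card) * |ε| := by
  rw [liftApprox_eq_sum _ _ _ _ _ _ hw, liftApprox_eq_sum _ _ _ _ _ _ hw,
    ← Finset.sum_sub_distrib, Finset.sum_mul]
  refine (Finset.abs_sum_le_sum_abs _ _).trans (Finset.sum_le_sum fun g _ => ?_)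
  have hprod : |∏ i, K s (bwList (g i)) (w.get i)| ≤ M ^ w.length := by
    rw [Finset.abs_prod]
    refine (Finset.prod_le_prod (fun i _ => abs_nonneg _) fun i _ => hK (g i) (w.get i)).trans ?_
    simp
  have hM : 0 ≤ M ^ w.length := (abs_nonneg _).trans hprod
  split_ifs with hg
  · rw [← mul_sub, abs_mul, mul_assoc]
    refine mul_le_mul hprod ?_ (abs_nonneg _) hM
    rw [← Multiset.sum_map_sub]
    refine (Multiset.abs_sum_le_sum_abs).trans ?_
    rw [Multiset.map_map, ← nsmul_eq_mul, ← Multiset.card_map (abs ∘ fun v => Y s t v - Y' s t v)]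
    refine Multiset.sum_le_card_nsmul _ _ fun y hy => ?_
    obtain ⟨v, hv, rfl⟩ := Multiset.mem_map.1 hy
    have hlen := (length_of_mem_oshMany_bwList hv).1
    refine (hY v ?_ (hlen ▸ hg.2)).trans (le_abs_self ε)
    rw [hlen]
    calc 2 ≤ w.length := hw
      _ = ∑ _i : Fin w.length, 1 := by simp
      _ ≤ ∑ i, ((g i).1 : ℕ) := Finset.sum_le_sum fun i _ => hg.1 i
  · rw [sub_zero, abs_zero]
    positivity

end Lift

section Uniqueness

/-- An additive two-parameter function which is `O(ω(s,t)^θ)` with `θ > 1` vanishes. -/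
theorem eq_zero_of_additive_of_abs_le_rpow {ω : ℝ → ℝ → ℝ} {T θ C : ℝ} (hω : IsControl ω T)
    (hθ : 1 < θ) {D : ℝ → ℝ → ℝ} (hcont : Continuous fun st : ℝ × ℝ => D st.1 st.2)
    (hadd : ∀ s u t, 0 ≤ s → s ≤ u → u ≤ t → t ≤ T → D s t = D s u + D u t)
    (hD : ∀ s t, 0 ≤ s → s ≤ t → t ≤ T → |D s t| ≤ C * ω s t ^ θ)
    {s t : ℝ} (hs : 0 ≤ s) (hst : s ≤ t) (ht : t ≤ T) : D s t = 0 := by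
  obtain ⟨hωc, hω0, hωnn, hωadd⟩ := hω
  have hDs : ∀ s, Continuous (D s) := fun s =>
    hcont.comp (by fun_prop : Continuous fun v : ℝ => (s, v))
  have hωs : ∀ s, Continuous (ω s) := fun s =>
    hωc.comp (by fun_prop : Continuous fun v : ℝ => (s, v))
  have hθ0 : 0 < θ - 1 := by linarith
  have key : ∀ ε, 0 < ε → |D s t| ≤ ε * ω s t := by
    intro ε hε
    have hclosed : IsClosed ({u | |D s u| ≤ ε * ω s u} ∩ Set.Icc s t) :=
      (isClosed_le (hDs s).abs (continuous_const.mul (hωs s))).inter isClosed_Icc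
    have hDss : D s s = 0 := by
      have := hadd s s s hs le_rfl le_rfl (hst.trans ht)
      linarith
    have hsub := hclosed.Icc_subset_of_forall_exists_gt (by simp [hDss, hω0]) (by
      rintro u ⟨hu, hu1, hu2⟩ v (hv : u < v)
      have hlim : Filter.Tendsto (fun r => |C| * ω u r ^ (θ - 1)) (nhdsWithin u (Set.Ioi u))
          (nhds 0) := by
        have hc : Continuous fun r => |C| * ω u r ^ (θ - 1) :=
          continuous_const.mul ((hωs u).rpow_const fun _ => Or.inr hθ0.le)
        have := hc.tendsto u
        rw [hω0, Real.zero_rpow hθ0.ne', mul_zero] at this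
        exact this.mono_left nhdsWithin_le_nhds
      have hmem : Set.Ioc u (min v t) ∈ nhdsWithin u (Set.Ioi u) :=
        Ioc_mem_nhdsGT (lt_min hv hu2)
      obtain ⟨r, hr, hr1, hr2⟩ :=
        ((hlim.eventually (gt_mem_nhds hε)).and hmem).exists
      have hrt : r ≤ t := hr2.trans (min_le_right _ _)
      refine ⟨r, ?_, hr1, hr2.trans (min_le_left _ _)⟩
      have hθ' : ω u r ^ θ = ω u r ^ (θ - 1) * ω u r := by
        rw [← Real.rpow_add_one' (hωnn u r) (by linarith), sub_add_cancel]
      have h1 : |D u r| ≤ ε * ω u r := by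
        calc |D u r| ≤ C * ω u r ^ θ := hD u r (hs.trans hu1) hr1.le (hrt.trans ht)
          _ ≤ |C| * ω u r ^ θ :=
            mul_le_mul_of_nonneg_right (le_abs_self C) (Real.rpow_nonneg (hωnn u r) _)
          _ = |C| * ω u r ^ (θ - 1) * ω u r := by rw [hθ', mul_assoc]
          _ ≤ ε * ω u r := mul_le_mul_of_nonneg_right hr.le (hωnn u r)
      have hu' : |D s u| ≤ ε * ω s u := hu
      change |D s r| ≤ ε * ω s r
      calc |D s r| = |D s u + D u r| := by rw [hadd s u r hs hu1 hr1.le (hrt.trans ht)]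
        _ ≤ |D s u| + |D u r| := abs_add_le _ _
        _ ≤ ε * ω s u + ε * ω u r := add_le_add hu' h1
        _ = ε * (ω s u + ω u r) := by ring
        _ ≤ ε * ω s r := mul_le_mul_of_nonneg_left
            (hωadd s u r hs hu1 hr1.le (hrt.trans ht)) hε.le)
    exact hsub ⟨hst, le_rfl⟩
  have h0 : |D s t| ≤ 0 := by
    have hlim : Filter.Tendsto (fun ε => ε * ω s t) (nhdsWithin 0 (Set.Ioi 0)) (nhds 0) := by
      have hc : Continuous fun ε : ℝ => ε * ω s t := by fun_prop
      have := hc.tendsto 0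
      rw [zero_mul] at this
      exact this.mono_left nhdsWithin_le_nhds
    exact ge_of_tendsto hlim (Filter.eventually_of_mem self_mem_nhdsWithin fun ε hε => key ε hε)
  exact abs_nonpos_iff.1 h0

/-- Two rough paths that agree up to `O(ω(s,t)^θ)` with `θ > 1` coincide. -/
theorem RoughPath.eq_of_abs_sub_le_rpow {d : ℕ} {p T θ : ℝ} {ω : ℝ → ℝ → ℝ}
    (hω : IsControl ω T) (hθ : 1 < θ) (Z Z' : RoughPath d p T ω)
    (h : ∀ w : List (Fin d), w.length ≤ ⌊p⌋₊ → ∃ C, ∀ s t, 0 ≤ s → s ≤ t → t ≤ T →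
      |Z.X s t w - Z'.X s t w| ≤ C * ω s t ^ θ)
    {s t : ℝ} (hs : 0 ≤ s) (hst : s ≤ t) (ht : t ≤ T) (w : List (Fin d)) :
    Z.X s t w = Z'.X s t w := by
  induction hn : w.length using Nat.strong_induction_on generalizing s t w with
  | _ n ih =>
    rcases lt_or_ge ⌊p⌋₊ w.length with hw | hw
    · rw [Z.zero_of_high s t w hw, Z'.zero_of_high s t w hw]
    rcases n with _ | n
    · rw [List.length_eq_zero_iff.1 hn, Z.empty_eq, Z'.empty_eq]
    obtain ⟨C, hC⟩ := h w hw
    rw [← sub_eq_zero]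
    refine eq_zero_of_additive_of_abs_le_rpow (D := fun s t => Z.X s t w - Z'.X s t w) hω hθ
      ((Z.cont w).sub (Z'.cont w)) ?_ hC hs hst ht
    intro s u t hs hsu hut ht
    have hmid : ∀ i ∈ Finset.range n,
        Z.X s u (w.take (i + 1)) * Z.X u t (w.drop (i + 1)) =
          Z'.X s u (w.take (i + 1)) * Z'.X u t (w.drop (i + 1)) := by
      intro i hi
      rw [Finset.mem_range] at hi
      rw [ih (i + 1) (by omega) hs hsu (hut.trans ht) (w.take (i + 1))
          (by rw [List.length_take]; omega),
        ih (n - i) (by omega) (hs.trans hsu) hut ht (w.drop (i + 1))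
          (by rw [List.length_drop]; omega)]
    have htake : w.take (n + 1) = w := List.take_of_length_le hn.le
    have hdrop : w.drop (n + 1) = [] := List.drop_of_length_le hn.le
    simp only [Z.chen s u t hs hsu hut ht w hw, Z'.chen s u t hs hsu hut ht w hw]
    rw [hn, Finset.sum_range_succ, Finset.sum_range_succ', Finset.sum_range_succ (fun i =>
      Z'.X s u (w.take i) * Z'.X u t (w.drop i)), Finset.sum_range_succ' _ n,
      Finset.sum_congr rfl hmid, htake, hdrop, List.take_zero, List.drop_zero, Z.empty_eq,
      Z'.empty_eq, Z.empty_eq, Z'.empty_eq]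
    ring

end Uniqueness

theorem exists_abs_bwList_le {e : ℕ} {ι : Type*} [Fintype ι] (N : ℕ) (T : ℝ)
    (K : ℝ → List (Fin e) → ι → ℝ) (hK : ∀ w k, Continuous fun t => K t w k) :
    ∃ M, ∀ s, 0 ≤ s → s ≤ T → ∀ (g : BWord e N) k, |K s (bwList g) k| ≤ M := by
  have hc : Continuous fun s => ∑ a : BWord e N × ι, |K s (bwList a.1) a.2| :=
    continuous_finsetSum _ fun a _ => (hK _ _).abs
  obtain ⟨M, hM⟩ := (isCompact_Icc (a := (0 : ℝ)) (b := T)).bddAbove_image hc.continuousOn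
  refine ⟨M, fun s hs hsT g k => ?_⟩
  refine le_trans ?_ (hM ⟨s, ⟨hs, hsT⟩, rfl⟩)
  exact Finset.single_le_sum (f := fun a : BWord e N × ι => |K s (bwList a.1) a.2|)
    (fun a _ => abs_nonneg _) (Finset.mem_univ (g, k))

/-- **functoriality of the lift.** With `H̄ ∈ D_X(U)`,
`𝐇 = ↑_X H̄` and `K̄ ∈ D_𝐇(S)`, the lift of the composite controlled path
equals the iterated lift: `↑_X(K̄ * H̄) = ↑_𝐇 K̄` in `C^p_ω([0,T],S)`. -/
theorem lift_starComp_eq_iterated_lift (d e f : ℕ) (p T : ℝ) (hp : 1 ≤ p)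
    (ω : ℝ → ℝ → ℝ) (hω : IsControl ω T) (R : RoughPath d p T ω)
    (H : ℝ → List (Fin d) → Fin e → ℝ)
    (hH : IsControlledPath d p T ω R.X H)
    (Y : RoughPath e p T ω)
    (hY : ∃ C, ∀ w : List (Fin e), w.length ≤ ⌊p⌋₊ → ∀ s t, 0 ≤ s → s ≤ t → t ≤ T →
      |Y.X s t w - liftApprox d ⌊p⌋₊ R.X H s t w| ≤ C * ω s t ^ (((⌊p⌋₊ : ℝ) + 1) / p))
    (K : ℝ → List (Fin e) → Fin f → ℝ)
    (hK : IsControlledPath e p T ω Y.X K)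
    (Z1 : RoughPath f p T ω)
    (hZ1 : ∃ C, ∀ w : List (Fin f), w.length ≤ ⌊p⌋₊ → ∀ s t, 0 ≤ s → s ≤ t → t ≤ T →
      |Z1.X s t w - liftApprox d ⌊p⌋₊ R.X (starComp d e f (⌊p⌋₊ - 1) K H) s t w|
        ≤ C * ω s t ^ (((⌊p⌋₊ : ℝ) + 1) / p))
    (Z2 : RoughPath f p T ω)
    (hZ2 : ∃ C, ∀ w : List (Fin f), w.length ≤ ⌊p⌋₊ → ∀ s t, 0 ≤ s → s ≤ t → t ≤ T →
      |Z2.X s t w - liftApprox e ⌊p⌋₊ Y.X K s t w| ≤ C * ω s t ^ (((⌊p⌋₊ : ℝ) + 1) / p)) :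
    ∀ s t, 0 ≤ s → s ≤ t → t ≤ T → ∀ w : List (Fin f), Z1.X s t w = Z2.X s t w := by
  have hN : 1 ≤ ⌊p⌋₊ := Nat.one_le_floor_iff p |>.2 hp
  have hθ : 1 < ((⌊p⌋₊ : ℝ) + 1) / p := by
    rw [one_lt_div (by linarith)]
    exact Nat.lt_floor_add_one p
  intro s t hs hst ht w
  refine RoughPath.eq_of_abs_sub_le_rpow hω hθ Z1 Z2 (fun w hw => ?_) hs hst ht w
  obtain ⟨C₁, hC₁⟩ := hZ1
  obtain ⟨C₂, hC₂⟩ := hZ2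
  obtain ⟨C₀, hC₀⟩ := hY
  obtain ⟨M, hM⟩ := exists_abs_bwList_le ⌊p⌋₊ T K hK.2.1
  suffices h : ∃ B, ∀ s t, 0 ≤ s → s ≤ t → t ≤ T →
      |liftApprox e ⌊p⌋₊ Y.X K s t w -
        liftApprox d ⌊p⌋₊ R.X (starComp d e f (⌊p⌋₊ - 1) K H) s t w| ≤
        B * ω s t ^ (((⌊p⌋₊ : ℝ) + 1) / p) by
    obtain ⟨B, hB⟩ := h
    refine ⟨C₁ + C₂ + B, fun s t hs hst ht => ?_⟩
    have h1 := abs_le.1 (hC₁ w hw s t hs hst ht)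
    have h2 := abs_le.1 (hC₂ w hw s t hs hst ht)
    have h3 := abs_le.1 (hB s t hs hst ht)
    rw [abs_le, add_mul, add_mul]
    constructor <;> linarith [h1.1, h1.2, h2.1, h2.2, h3.1, h3.2]
  match w, hw with
  | [], _ => exact ⟨0, fun s t _ _ _ => by simp [liftApprox]⟩
  | [c], _ => exact ⟨0, fun s t _ _ _ => by simp [liftApprox, starComp]⟩
  | k1 :: k2 :: ks, _ =>
    refine ⟨(∑ g : Fin (k1 :: k2 :: ks).length → BWord e ⌊p⌋₊, M ^ (k1 :: k2 :: ks).length *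
      (oshMany (List.ofFn fun i => bwList (g i))).card) * |C₀|, fun s t hs hst ht => ?_⟩
    have hX : ∀ v, ⌊p⌋₊ < v.length → R.X s t v = 0 := R.zero_of_high s t
    rw [← liftApprox_letterLift d e f ⌊p⌋₊ hN R.X K H s t hX (hH.1 s) (by simp), mul_assoc,
      ← abs_of_nonneg (Real.rpow_nonneg (hω.2.2.1 s t) (((⌊p⌋₊ : ℝ) + 1) / p)), ← abs_mul]
    refine abs_liftApprox_sub_le e ⌊p⌋₊ Y.X (letterLift d ⌊p⌋₊ R.X H) K s t _ M
      (fun v hv hvN => ?_) (fun g k => hM s hs (hst.trans ht) g k) (by simp)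
    have h := hC₀ v hvN s t hs hst ht
    rwa [liftApprox_eq_linearCombination _ _ _ _ _ _ hX hv] at h
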